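/- Let Γ' be a finite connected graph with first Betti number g', edge weights w(e) ∈ ℤ \ {0}, and A the weighted cycle-edge matrix as above. Then the index of the sublattice A(ℤ^B) inside ℤ^{g'} equals gcd over all spanning trees T of Γ' of ∏_{e ∈ T^c} w(e). -/

import Mathlib

/-- Signed incidence of oriented edge `e` at vertex `v`. -/
def edgeInc {V E : Type*} [DecidableEq V] (ends : E → V × V) (e : E) (v : V) : ℤ :=
  (if (ends e).1 = v then 1 else 0) - (if (ends e).2 = v then 1 else 0)

/-- Integer flow (cycle-space element, i.e. class in `H₁(Γ',ℤ)`). -/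
def IsFlow {V E : Type*} [DecidableEq V] [Fintype E] (ends : E → V × V) (z : E → ℤ) : Prop :=
  ∀ v : V, ∑ e, z e * edgeInc ends e v = 0

/-- Adjacency of vertices via an edge from the set `T`. -/
def AdjVia {V E : Type*} (ends : E → V × V) (T : Set E) (u v : V) : Prop :=
  ∃ e ∈ T, ends e = (u, v) ∨ ends e = (v, u)

/-- The multigraph is connected. -/
def IsConnectedGraph {V E : Type*} (ends : E → V × V) : Prop :=
  ∀ u v : V, Relation.ReflTransGen (AdjVia ends Set.univ) u v

/-- `T` is a spanning tree: acyclic (no nonzero flow supported on `T`) and connecting. -/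
def IsSpanningTree {V E : Type*} [DecidableEq V] [Fintype E]
    (ends : E → V × V) (T : Finset E) : Prop :=
  (∀ z : E → ℤ, IsFlow ends z → (∀ e ∉ T, z e = 0) → z = 0) ∧
  (∀ u v : V, Relation.ReflTransGen (AdjVia ends (↑T : Set E)) u v)

section LatticeIndex

open Matrix

variable {m n : Type*} [Fintype m] [DecidableEq m] [Fintype n]

/-- The index of the lattice spanned by the columns of a nonsingular square integer matrix. -/
theorem Matrix.index_range_mulVecLin_eq_natAbs_det (B : Matrix m m ℤ) (hB : B.det ≠ 0) :
    (LinearMap.range B.mulVecLin).toAddSubgroup.index = B.det.natAbs := by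
  have hinj : Function.Injective B.mulVecLin := by
    rw [injective_iff_map_eq_zero]
    exact fun v hv => Matrix.eq_zero_of_mulVec_eq_zero hB hv
  have h := Submodule.natAbs_det_equiv (LinearMap.range B.mulVecLin)
    (LinearEquiv.ofInjective B.mulVecLin hinj)
  have hcomp : (LinearMap.range B.mulVecLin).subtype ∘ₗ AddMonoidHom.toIntLinearMap
      ((LinearEquiv.ofInjective B.mulVecLin hinj : (m → ℤ) ≃ₗ[ℤ] _) :
        (m → ℤ) →+ LinearMap.range B.mulVecLin) = Matrix.toLin' B := by
    ext; rfl
  rw [hcomp, LinearMap.det_toLin'] at h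
  exact h.symm

/-- Every maximal minor of a product `A * D` is an integer combination of those of `A`. -/
theorem Matrix.dvd_det_mul_of_forall_dvd_det_submatrix (A : Matrix m n ℤ) (D : Matrix n m ℤ)
    (d : ℤ) (hd : ∀ f : m → n, d ∣ (A.submatrix id f).det) : d ∣ (A * D).det := by
  classical
  have hrow : (A * D)ᵀ = fun j => ∑ e, D e j • Aᵀ e := by
    ext j i
    simp [Matrix.mul_apply, mul_comm]
  have hsum : (A * D).det = ∑ f : m → n, (∏ j, D (f j) j) * (A.submatrix id f).det := by
    rw [← Matrix.det_transpose, hrow]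
    change (Matrix.detRowAlternating (R := ℤ) (n := m)).toMultilinearMap _ = _
    rw [MultilinearMap.map_sum]
    refine Finset.sum_congr rfl fun f _ => ?_
    rw [MultilinearMap.map_smul_univ, smul_eq_mul, ← Matrix.det_transpose (A.submatrix id f)]
    rfl
  rw [hsum]
  exact Finset.dvd_sum fun f _ => (hd f).mul_left _

/-- The index of the lattice spanned by the columns of an integer matrix is the gcd of its
maximal minors. -/
theorem Matrix.index_range_mulVecLin_eq_gcd [DecidableEq n] (A : Matrix m n ℤ) :
    (LinearMap.range A.mulVecLin).toAddSubgroup.index =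
      Finset.univ.gcd fun f : m → n => (A.submatrix id f).det.natAbs := by
  apply Nat.dvd_antisymm
  · refine Finset.dvd_gcd fun f _ => ?_
    by_cases h0 : (A.submatrix id f).det = 0
    · simp [h0]
    rw [← Matrix.index_range_mulVecLin_eq_natAbs_det _ h0]
    refine AddSubgroup.index_dvd_of_le ?_
    rintro _ ⟨v, rfl⟩
    refine ⟨∑ j, v j • Pi.single (f j) 1, ?_⟩
    ext i
    simp only [map_sum, map_smul, Matrix.mulVecLin_apply, Matrix.mulVec_single_one]
    simp [Matrix.mulVec, dotProduct, mul_comm]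
  · by_cases h0 : (LinearMap.range A.mulVecLin).toAddSubgroup.index = 0
    · simp [h0]
    obtain ⟨e⟩ := Int.submodule_toAddSubgroup_index_ne_zero_iff.mp h0
    let b := Module.Basis.ofEquivFun e
    have hcard : (LinearMap.range A.mulVecLin).toAddSubgroup.index = _ :=
      (Submodule.natAbs_det_basis_change (Pi.basisFun ℤ m) _ b).symm
    have hmem : ∀ j, ∃ v, A.mulVecLin v = (b j : m → ℤ) := fun j => (b j).2
    choose v hv using hmem
    have hmul : (Pi.basisFun ℤ m).toMatrix (Subtype.val ∘ b) = A * (Matrix.of v)ᵀ := by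
      ext i j
      simp [Module.Basis.toMatrix_apply, ← hv, Matrix.mulVec, dotProduct, Matrix.mul_apply]
    rw [hcard, Module.Basis.det_apply, hmul, ← Int.natCast_dvd]
    refine Matrix.dvd_det_mul_of_forall_dvd_det_submatrix _ _ _ fun f => ?_
    rw [Int.natCast_dvd]
    exact Finset.gcd_dvd (Finset.mem_univ f)

end LatticeIndex

section Flow

variable {V E : Type*} [DecidableEq V] [Fintype E] {ends : E → V × V}

theorem IsFlow.sub {x y : E → ℤ} (hx : IsFlow ends x) (hy : IsFlow ends y) :
    IsFlow ends (x - y) := fun v => by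
  simp [sub_mul, Finset.sum_sub_distrib, hx v, hy v]

theorem IsFlow.sum_smul {ι : Type*} [Fintype ι] (c : ι → ℤ) {y : ι → E → ℤ}
    (hy : ∀ i, IsFlow ends (y i)) : IsFlow ends (∑ i, c i • y i) := fun v => by
  simp only [Finset.sum_apply, Pi.smul_apply, smul_eq_mul, Finset.sum_mul, mul_assoc]
  rw [Finset.sum_comm]
  simp [← Finset.mul_sum, hy _ v]

/-- A flow is orthogonal to every coboundary. -/
theorem IsFlow.sum_mul_coboundary [Fintype V] {y : E → ℤ} (hy : IsFlow ends y) (c : V → ℤ) :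
    ∑ e, y e * (c (ends e).1 - c (ends e).2) = 0 := by
  have h : ∀ e, c (ends e).1 - c (ends e).2 = ∑ v, edgeInc ends e v * c v := fun e => by
    simp [edgeInc, sub_mul]
  simp only [h, Finset.mul_sum, ← mul_assoc]
  rw [Finset.sum_comm]
  simp [← Finset.sum_mul, hy _]

/-- A path inside `T` carries a chain supported on `T` with boundary the difference of its
end points. -/
theorem exists_chain_of_reflTransGen [DecidableEq E] {T : Finset E} {u v : V}
    (h : Relation.ReflTransGen (AdjVia ends (↑T : Set E)) u v) :
    ∃ p : E → ℤ, (∀ e ∉ T, p e = 0) ∧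
      ∀ x, ∑ e, p e * edgeInc ends e x = (if u = x then 1 else 0) - (if v = x then 1 else 0) := by
  induction h with
  | refl => exact ⟨0, by simp⟩
  | tail _ hab ih =>
    obtain ⟨p, hpT, hp⟩ := ih
    obtain ⟨e, heT, he⟩ := hab
    have hne : ∀ e' ∉ T, e' ≠ e := fun e' h' hee => h' (hee ▸ heT)
    rcases he with he | he
    · refine ⟨p + Pi.single e 1, fun e' h' => ?_, fun x => ?_⟩
      · simp [hpT e' h', hne e' h']
      · simp [add_mul, Finset.sum_add_distrib, hp, Pi.single_apply]
        simp [edgeInc, he]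
    · refine ⟨p - Pi.single e 1, fun e' h' => ?_, fun x => ?_⟩
      · simp [hpT e' h', hne e' h']
      · simp [sub_mul, Finset.sum_sub_distrib, hp, Pi.single_apply]
        simp [edgeInc, he]

/-- The family `y` consists of the fundamental cycles of the edges outside `T`, which are
enumerated by `s`. -/
structure IsFundamentalSystem {ι : Type*} (ends : E → V × V) (T : Finset E) (s : ι → E)
    (y : ι → E → ℤ) : Prop where
  injective : Function.Injective s
  exists_eq : ∀ e ∉ T, ∃ i, s i = e
  isFlow : ∀ i, IsFlow ends (y i)
  apply_self : ∀ i, y i (s i) = 1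
  apply_of_ne : ∀ i, ∀ e ∉ T, e ≠ s i → y i e = 0

theorem IsSpanningTree.exists_isFundamentalSystem [DecidableEq E] {T : Finset E}
    (hT : IsSpanningTree ends T) :
    ∃ y : {e // e ∉ T} → E → ℤ, IsFundamentalSystem ends T Subtype.val y := by
  choose p hpT hp using fun e : {e // e ∉ T} =>
    exists_chain_of_reflTransGen (hT.2 (ends e).1 (ends e).2)
  refine ⟨fun e => Pi.single e.1 1 - p e, Subtype.val_injective, fun e he => ⟨⟨e, he⟩, rfl⟩,
    fun e v => ?_, fun e => ?_, fun e e' he' hne => ?_⟩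
  · simp [sub_mul, Finset.sum_sub_distrib, hp, Pi.single_apply]
    simp [edgeInc]
  · simp [hpT e e e.2]
  · simp [hpT e e' he', hne]

namespace IsFundamentalSystem

variable {ι : Type*} {T : Finset E} {s : ι → E} {y : ι → E → ℤ}

theorem apply_eq_ite [DecidableEq ι] (h : IsFundamentalSystem ends T s y) (hs : ∀ i, s i ∉ T)
    (i j : ι) : y i (s j) = if i = j then 1 else 0 := by
  split_ifs with hij
  · rw [← hij, h.apply_self]
  · exact h.apply_of_ne i _ (hs j) fun h' => hij (h.injective h').symm

/-- Every flow is the combination of the fundamental cycles given by its values off the tree. -/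
theorem eq_sum [Fintype ι] (h : IsFundamentalSystem ends T s y) (hs : ∀ i, s i ∉ T)
    (hT : IsSpanningTree ends T) {x : E → ℤ} (hx : IsFlow ends x) :
    x = ∑ i, x (s i) • y i := by
  classical
  refine sub_eq_zero.mp (hT.1 _ (hx.sub (IsFlow.sum_smul _ h.isFlow)) fun e he => ?_)
  obtain ⟨j, rfl⟩ := h.exists_eq e he
  simp [h.apply_eq_ite hs]

variable [Fintype ι] [DecidableEq ι]

/-- For every spanning tree, the minor of the cycle matrix on its complement is a unit. -/
theorem exists_natAbs_det_eq_one [DecidableEq E] (h : IsFundamentalSystem ends T s y)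
    (hs : ∀ i, s i ∉ T) (hT : IsSpanningTree ends T) {T' : Finset E}
    (hT' : IsSpanningTree ends T') :
    ∃ f : ι → E, Function.Injective f ∧ Finset.univ.image f = T'ᶜ ∧
      ((Matrix.of y).submatrix id f).det.natAbs = 1 := by
  obtain ⟨y', h'⟩ := hT'.exists_isFundamentalSystem
  let Z : Matrix ι {e // e ∉ T'} ℤ := Matrix.of fun i e => y i e
  let Y : Matrix {e // e ∉ T'} ι ℤ := Matrix.of fun e i => y' e (s i)
  have hZY : Z * Y = 1 := by
    ext i k
    have hik := congrFun (h'.eq_sum Subtype.prop hT' (h.isFlow i)) (s k)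
    simp only [Finset.sum_apply, Pi.smul_apply, smul_eq_mul] at hik
    simp only [Matrix.mul_apply, Z, Y, Matrix.of_apply, ← hik, Matrix.one_apply,
      h.apply_eq_ite hs]
  have hYZ : Y * Z = 1 := by
    ext e e'
    have hee := congrFun (h.eq_sum hs hT (h'.isFlow e)) e'
    simp only [Finset.sum_apply, Pi.smul_apply, smul_eq_mul] at hee
    simp only [Matrix.mul_apply, Z, Y, Matrix.of_apply, ← hee, Matrix.one_apply,
      h'.apply_eq_ite Subtype.prop]
  let σ : ι ≃ {e // e ∉ T'} := Matrix.indexEquivOfInv hZY hYZ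
  refine ⟨fun i => σ i, Subtype.val_injective.comp σ.injective, ?_, ?_⟩
  · ext e
    simp only [Finset.mem_image, Finset.mem_univ, true_and, Finset.mem_compl]
    exact ⟨fun ⟨i, hi⟩ => hi ▸ (σ i).2, fun he => ⟨σ.symm ⟨e, he⟩, by simp⟩⟩
  · have hmul : (Matrix.of y).submatrix id (fun i => (σ i).1) * Y.submatrix σ id = 1 := by
      have : (Matrix.of y).submatrix id (fun i => (σ i).1) = Z.submatrix id σ := rfl
      rw [this, Matrix.submatrix_mul_equiv, hZY, Matrix.submatrix_id_id]
    exact Int.isUnit_iff_natAbs_eq.mp (Matrix.isUnit_det_of_right_inverse hmul)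

/-- The column sets of nonvanishing maximal minors of the cycle matrix are complements of
spanning trees. -/
theorem isSpanningTree_of_det_ne_zero [Fintype V] [DecidableEq E]
    (h : IsFundamentalSystem ends T s y) (hs : ∀ i, s i ∉ T) (hT : IsSpanningTree ends T)
    (hconn : IsConnectedGraph ends) {f : ι → E} (hf : Function.Injective f)
    (hdet : ((Matrix.of y).submatrix id f).det ≠ 0) :
    IsSpanningTree ends (Finset.univ.image f)ᶜ := by
  classical
  constructor
  · intro x hx hxf
    have hx0 : (fun i => x (s i)) = 0 := by
      refine Matrix.eq_zero_of_vecMul_eq_zero hdet ?_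
      ext j
      have hj := congrFun (h.eq_sum hs hT hx) (f j)
      rw [hxf (f j) (by simp)] at hj
      simpa [Matrix.vecMul, dotProduct] using hj.symm
    rw [h.eq_sum hs hT hx]
    exact Finset.sum_eq_zero fun i _ => by rw [show x (s i) = 0 from congrFun hx0 i, zero_smul]
  · intro u v
    by_contra huv
    let R := AdjVia ends (↑(Finset.univ.image f)ᶜ : Set E)
    let c : V → ℤ := fun x => if Relation.ReflTransGen R u x then 1 else 0
    have hR : ∀ a b, R a b → c a = c b := fun a b hab => by
      have hba : R b a := by
        obtain ⟨e, he, h1⟩ := hab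
        exact ⟨e, he, h1.symm⟩
      have : Relation.ReflTransGen R u a ↔ Relation.ReflTransGen R u b :=
        ⟨fun hu => hu.tail hab, fun hu => hu.tail hba⟩
      simp only [c, this]
    let d : E → ℤ := fun e => c (ends e).1 - c (ends e).2
    have hd : ∀ e ∉ Finset.univ.image f, d e = 0 := fun e he =>
      sub_eq_zero.mpr (hR _ _ ⟨e, by simpa using he, Or.inl rfl⟩)
    have hdf : (fun j => d (f j)) = 0 := by
      refine Matrix.eq_zero_of_mulVec_eq_zero hdet ?_
      ext i
      have hi := (h.isFlow i).sum_mul_coboundary c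
      rw [← Finset.sum_subset (Finset.subset_univ (Finset.univ.image f)) fun e _ he => by
        rw [show c (ends e).1 - c (ends e).2 = 0 from hd e he, mul_zero],
        Finset.sum_image hf.injOn] at hi
      simpa [Matrix.mulVec, dotProduct] using hi
    have hd0 : ∀ e, c (ends e).1 = c (ends e).2 := fun e => by
      by_cases he : e ∈ Finset.univ.image f
      · obtain ⟨j, -, rfl⟩ := Finset.mem_image.mp he
        exact sub_eq_zero.mp (congrFun hdf j)
      · exact sub_eq_zero.mp (hd e he)
    have hc : ∀ x, Relation.ReflTransGen (AdjVia ends Set.univ) u x → c u = c x := by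
      intro x hx
      induction hx with
      | refl => rfl
      | tail _ hab ih =>
        obtain ⟨e, -, he | he⟩ := hab
        · simpa [ih, he] using hd0 e
        · simpa [ih, he] using (hd0 e).symm
    have huv' := hc v (hconn u v)
    simp only [c, R, if_neg huv, if_pos Relation.ReflTransGen.refl] at huv'
    exact one_ne_zero huv'

end IsFundamentalSystem

end Flow

open Classical in
/-- With `Γ'` a finite connected multigraph of first Betti number `g'`,
nonzero edge weights `w`, and `A` the weighted cycle-edge matrix with respect to the
fundamental-cycle basis of a spanning tree `T₀` (entries `z i e * w e`, where `z i` is the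
fundamental cycle of the `i`-th non-tree edge), the index of the sublattice `A(ℤ^B)` inside
`ℤ^{g'}` equals the gcd, over all spanning trees `T` of `Γ'`, of `∏_{e ∈ T^c} |w e|`.
(Non-spanning-tree subsets contribute `0`, which is neutral for `gcd`.) -/

theorem lattice_index_eq_gcd_over_spanning_trees
    {V E : Type*} [Fintype V] [Fintype E] [DecidableEq V] [DecidableEq E]
    (ends : E → V × V) (hconn : IsConnectedGraph ends)
    (w : E → ℤ) (hw : ∀ e, w e ≠ 0)
    (g' : ℕ) (T₀ : Finset E) (hT₀ : IsSpanningTree ends T₀)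
    (nt : Fin g' → E) (hntInj : Function.Injective nt)
    (hntC : ∀ i, nt i ∉ T₀) (hntAll : ∀ e ∉ T₀, ∃ i, nt i = e)
    (z : Fin g' → E → ℤ)
    (hz : ∀ i, IsFlow ends (z i) ∧ z i (nt i) = 1 ∧
      ∀ e, e ∉ T₀ → e ≠ nt i → z i e = 0)
    (A : Matrix (Fin g') E ℤ) (hA : ∀ i e, A i e = z i e * w e) :
    (LinearMap.range (Matrix.mulVecLin A)).toAddSubgroup.index =
      Finset.gcd Finset.univ
        (fun T : Finset E =>
          if IsSpanningTree ends T then ∏ e ∈ Tᶜ, (w e).natAbs else 0) := by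
  have hF : IsFundamentalSystem ends T₀ nt z :=
    ⟨hntInj, hntAll, fun i => (hz i).1, fun i => (hz i).2.1, fun i => (hz i).2.2⟩
  have hminor : ∀ f : Fin g' → E, (A.submatrix id f).det.natAbs =
      (∏ j, (w (f j)).natAbs) * ((Matrix.of z).submatrix id f).det.natAbs := fun f => by
    have hAf : A.submatrix id f =
        Matrix.of fun i j => w (f j) * (Matrix.of z).submatrix id f i j := by
      ext i j
      simp [hA, mul_comm]
    rw [hAf, Matrix.det_mul_row, Int.natAbs_mul]
    exact congrArg (· * _) (map_prod Int.natAbsHom _ _)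
  rw [Matrix.index_range_mulVecLin_eq_gcd]
  apply Nat.dvd_antisymm
  · refine Finset.dvd_gcd fun T _ => ?_
    split_ifs with hT
    · obtain ⟨f, hf, hfT, hdet⟩ := hF.exists_natAbs_det_eq_one hntC hT₀ hT
      rw [← hfT, Finset.prod_image hf.injOn]
      have hdvd := Finset.gcd_dvd (f := fun f : Fin g' → E => (A.submatrix id f).det.natAbs)
        (Finset.mem_univ f)
      rwa [hminor, hdet, mul_one] at hdvd
    · exact dvd_zero _
  · refine Finset.dvd_gcd fun f _ => ?_
    rw [hminor]
    by_cases hdet : ((Matrix.of z).submatrix id f).det = 0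
    · simp [hdet]
    have hf : Function.Injective f := fun i j hij => by
      by_contra hne
      exact hdet (Matrix.det_zero_of_column_eq hne fun k => by simp [hij])
    have hT := hF.isSpanningTree_of_det_ne_zero hntC hT₀ hconn hf hdet
    have hdvd := Finset.gcd_dvd (f := fun T : Finset E =>
      if IsSpanningTree ends T then ∏ e ∈ Tᶜ, (w e).natAbs else 0)
      (Finset.mem_univ (Finset.univ.image f)ᶜ)
    rw [if_pos hT, compl_compl, Finset.prod_image hf.injOn] at hdvd
    exact hdvd.mul_right _
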